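/- Fix a real η > 1 and a real α > η/(η−1), and let P_α be the Pareto distribution with shape α. Then S_{P_α} = ∫ s(v) dP_α(v) is finite, and the supremum of the expected profit ∫ (T(v) − Q(v)^η/η) dP_α(v) over all incentive-compatible, individually rational direct mechanisms (Q, T) (with measurable Q, T and well-defined integral) equals ((α−1)/α)^{η/(η−1)} · S_{P_α}. -/

import Mathlib

open Real Set MeasureTheory

/-- The efficient (first-best) surplus at value `v` in the quality-discrimination
model with cost `c q = q ^ η / η`: `s v = ((η - 1)/η) * v ^ (η/(η-1))`. -/
noncomputable def effSurplus (η : ℝ) (v : ℝ) : ℝ := (η - 1) / η * v ^ (η / (η - 1))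

/-- The set of expected profits achievable by incentive-compatible, individually
rational direct mechanisms `(Q, T)` (with measurable `Q`, `T` and well-defined
profit integral) when the value distribution is `μ`. -/
def profitSet (η : ℝ) (μ : Measure ℝ) : Set ℝ :=
  {x | ∃ Q T : ℝ → ℝ, Measurable Q ∧ Measurable T ∧
    (∀ v : ℝ, 0 ≤ v → 0 ≤ Q v) ∧
    (∀ v v' : ℝ, 0 ≤ v → 0 ≤ v' → v * Q v' - T v' ≤ v * Q v - T v) ∧
    (∀ v : ℝ, 0 ≤ v → 0 ≤ v * Q v - T v) ∧
    Integrable (fun v => T v - Q v ^ η / η) μ ∧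
    x = ∫ v, (T v - Q v ^ η / η) ∂μ}

/-- The Pareto distribution with shape `α`: the measure on `[1, ∞)` with density
`α * v ^ (-α - 1)` with respect to Lebesgue measure. -/
noncomputable def paretoMeasure (α : ℝ) : Measure ℝ :=
  (volume.restrict (Set.Ici (1 : ℝ))).withDensity
    (fun v => ENNReal.ofReal (α * v ^ (-α - 1)))

lemma pareto_ae (α : ℝ) : ∀ᵐ v ∂(paretoMeasure α), 1 ≤ v := by
  have h : ∀ᵐ v ∂(volume.restrict (Set.Ici (1 : ℝ))), v ∈ Set.Ici (1 : ℝ) :=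
    ae_restrict_mem measurableSet_Ici
  exact (withDensity_absolutelyContinuous _ _).ae_le h

lemma pareto_integrable (α : ℝ) (hα : 0 < α) (f : ℝ → ℝ) :
    Integrable f (paretoMeasure α) ↔
      IntegrableOn (fun v => α * v ^ (-α - 1) * f v) (Ioi 1) := by
  unfold paretoMeasure
  rw [integrable_withDensity_iff_integrable_smul' (by fun_prop) (by simp)]
  rw [← integrableOn_Ici_iff_integrableOn_Ioi]
  refine integrableOn_congr_fun ?_ measurableSet_Ici
  intro v hv
  have hv' : (0 : ℝ) ≤ v := zero_le_one.trans hv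
  simp only [smul_eq_mul]
  rw [ENNReal.toReal_ofReal (by positivity)]

lemma pareto_integral (α : ℝ) (hα : 0 < α) (f : ℝ → ℝ) :
    ∫ v, f v ∂(paretoMeasure α) = ∫ v in Ioi 1, α * v ^ (-α - 1) * f v := by
  unfold paretoMeasure
  rw [integral_withDensity_eq_integral_toReal_smul (by fun_prop) (by simp)]
  rw [← integral_Ici_eq_integral_Ioi]
  refine setIntegral_congr_fun measurableSet_Ici ?_
  intro v hv
  have hv' : (0 : ℝ) ≤ v := zero_le_one.trans hv
  simp only [smul_eq_mul]
  rw [ENNReal.toReal_ofReal (by positivity)]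

lemma pareto_rpow (α p : ℝ) (hα : 0 < α) (hp : p < α) :
    Integrable (fun v => v ^ p) (paretoMeasure α) ∧
      ∫ v, v ^ p ∂(paretoMeasure α) = α / (α - p) := by
  have e : EqOn (fun v : ℝ => α * v ^ (-α - 1 + p)) (fun v => α * v ^ (-α - 1) * v ^ p)
      (Ioi 1) := by
    intro v hv
    have hv' : (0 : ℝ) < v := zero_lt_one.trans hv
    simp only
    rw [rpow_add hv', mul_assoc]
  rw [pareto_integrable α hα, pareto_integral α hα]
  constructor
  · exact IntegrableOn.congr_fun
      ((integrableOn_Ioi_rpow_of_lt (by linarith) zero_lt_one).const_mul α) e measurableSet_Ioi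
  · rw [← setIntegral_congr_fun measurableSet_Ioi e, integral_const_mul,
      integral_Ioi_rpow_of_lt (by linarith) zero_lt_one, one_rpow]
    have h1 : α - p ≠ 0 := by linarith
    have h2 : -α - 1 + p + 1 ≠ 0 := by
      intro h; apply h1; linarith
    field_simp
    ring

lemma pareto_scale (α : ℝ) (hα : 0 < α) (U : ℝ → ℝ) (hU : ∀ v, 0 ≤ v → 0 ≤ U v)
    (hI : Integrable U (paretoMeasure α)) (l : ℝ) (hl : 1 < l) :
    Integrable (fun v => U (l * v)) (paretoMeasure α) ∧
    ∫ v, U (l * v) ∂(paretoMeasure α) ≤ l ^ α * ∫ v, U v ∂(paretoMeasure α) := by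
  have hl0 : 0 < l := by linarith
  rw [pareto_integrable α hα] at hI
  rw [pareto_integrable α hα, pareto_integral α hα, pareto_integral α hα]
  set g : ℝ → ℝ := fun w => α * w ^ (-α - 1) * U w with hg
  have e : EqOn (fun v : ℝ => l ^ (α + 1) * g (l * v))
      (fun v => α * v ^ (-α - 1) * U (l * v)) (Ioi 1) := by
    intro v hv
    have hv' : (0 : ℝ) < v := zero_lt_one.trans hv
    simp only [hg]
    rw [mul_rpow hl0.le hv'.le]
    have : l ^ (α + 1) * l ^ (-α - 1) = 1 := by
      rw [← rpow_add hl0]; ring_nf; simp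
    linear_combination (α * v ^ (-α - 1) * U (l * v)) * this
  have hsub : Ioi (l * 1) ⊆ Ioi (1 : ℝ) := Ioi_subset_Ioi (by linarith)
  constructor
  · refine IntegrableOn.congr_fun (Integrable.const_mul ?_ _) e measurableSet_Ioi
    exact (integrableOn_Ioi_comp_mul_left_iff g 1 hl0).2 (hI.mono_set hsub)
  · rw [← setIntegral_congr_fun measurableSet_Ioi e, integral_const_mul,
      integral_comp_mul_left_Ioi g 1 hl0, smul_eq_mul, ← mul_assoc]
    have : l ^ (α + 1) * l⁻¹ = l ^ α := by
      rw [rpow_add_one hl0.ne']; field_simp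
    rw [this]
    refine mul_le_mul_of_nonneg_left ?_ (rpow_nonneg hl0.le _)
    refine setIntegral_mono_set hI ?_ hsub.eventuallyLE
    filter_upwards [ae_restrict_mem measurableSet_Ioi] with v hv
    have hv' : (0 : ℝ) < v := zero_lt_one.trans hv
    have := hU v hv'.le
    simp only [hg, Pi.zero_apply]
    positivity

lemma slope_limit (α A B : ℝ) (h : ∀ l : ℝ, 1 < l → (l - 1) * A ≤ (l ^ α - 1) * B) :
    A ≤ α * B := by
  have hd : HasDerivAt (fun x : ℝ => x ^ α * B) (α * B) 1 := by
    have := (Real.hasDerivAt_rpow_const (x := 1) (p := α) (Or.inl one_ne_zero)).mul_const B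
    simpa using this
  have ht := (hasDerivAt_iff_tendsto_slope_left_right.1 hd).2
  refine ge_of_tendsto ht ?_
  filter_upwards [self_mem_nhdsWithin] with l hl
  have hl' : 0 < l - 1 := sub_pos.2 hl
  rw [slope_def_field, le_div_iff₀ hl']
  have := h l hl
  simp only [one_rpow]
  linarith

lemma eff_young (η : ℝ) (hη : 1 < η) (w q : ℝ) (hw : 0 ≤ w) (hq : 0 ≤ q) :
    w * q - q ^ η / η ≤ effSurplus η w := by
  have hc : (η / (η - 1)).HolderConjugate η := (Real.HolderConjugate.conjExponent hη).symm
  have := Real.young_inequality_of_nonneg hw hq hc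
  unfold effSurplus
  have e : w ^ (η / (η - 1)) / (η / (η - 1)) = (η - 1) / η * w ^ (η / (η - 1)) := by
    have : η - 1 ≠ 0 := by linarith
    field_simp
  linarith

lemma profit_le (η α : ℝ) (hη : 1 < η) (hα : η / (η - 1) < α) (hα1 : 1 < α)
    (hS : Integrable (effSurplus η) (paretoMeasure α)) (x : ℝ)
    (hx : x ∈ profitSet η (paretoMeasure α)) :
    x ≤ ((α - 1) / α) ^ (η / (η - 1)) * ∫ v, effSurplus η v ∂(paretoMeasure α) := by
  obtain ⟨Q, T, hQm, hTm, hQ, hIC, hIR, hP, rfl⟩ := hx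
  have hα0 : 0 < α := by linarith
  set U : ℝ → ℝ := fun v => v * Q v - T v with hUdef
  have hUm : Measurable U := by fun_prop
  have hUi : Integrable U (paretoMeasure α) := by
    refine (hS.sub hP).mono' hUm.aestronglyMeasurable ?_
    filter_upwards [pareto_ae α] with v hv
    have hv0 : 0 ≤ v := by linarith
    rw [Real.norm_of_nonneg (hIR v hv0)]
    have := eff_young η hη v (Q v) hv0 (hQ v hv0)
    simp only [hUdef, Pi.sub_apply]
    linarith
  have key : ∀ l : ℝ, 1 < l → ∀ v : ℝ, 1 ≤ v → (l - 1) * (v * Q v) ≤ U (l * v) - U v := by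
    intro l hl v hv
    have hv0 : 0 ≤ v := by linarith
    have := hIC (l * v) v (by positivity) hv0
    simp only [hUdef]
    linarith
  have hscale := pareto_scale α hα0 U hIR hUi
  have hVi : Integrable (fun v => v * Q v) (paretoMeasure α) := by
    refine ((hscale 2 (by norm_num)).1.sub hUi).mono' (by fun_prop) ?_
    filter_upwards [pareto_ae α] with v hv
    have hv0 : 0 ≤ v := by linarith
    rw [Real.norm_of_nonneg (mul_nonneg hv0 (hQ v hv0))]
    have := key 2 (by norm_num) v hv
    simp only [Pi.sub_apply]
    linarith
  have hAB : ∫ v, v * Q v ∂(paretoMeasure α) ≤ α * ∫ v, U v ∂(paretoMeasure α) := by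
    apply slope_limit
    intro l hl
    obtain ⟨h1, h2⟩ := hscale l hl
    have h3 : ∫ v, (l - 1) * (v * Q v) ∂(paretoMeasure α)
        ≤ ∫ v, (U (l * v) - U v) ∂(paretoMeasure α) := by
      refine integral_mono_ae (hVi.const_mul _) (h1.sub hUi) ?_
      filter_upwards [pareto_ae α] with v hv using key l hl v hv
    rw [integral_const_mul, integral_sub h1 hUi] at h3
    linarith
  have hfin : ∫ v, (T v - Q v ^ η / η) ∂(paretoMeasure α) ≤
      ∫ v, ((((α - 1) / α) ^ (η / (η - 1)) * effSurplus η v) + (α⁻¹ * (v * Q v) - U v))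
        ∂(paretoMeasure α) := by
    refine integral_mono_ae hP ((hS.const_mul _).add ((hVi.const_mul _).sub hUi)) ?_
    filter_upwards [pareto_ae α] with v hv
    have hv0 : 0 ≤ v := by linarith
    have hb : 0 ≤ (α - 1) / α := div_nonneg (by linarith) hα0.le
    have := eff_young η hη ((α - 1) / α * v) (Q v) (by positivity) (hQ v hv0)
    have e : effSurplus η ((α - 1) / α * v)
        = ((α - 1) / α) ^ (η / (η - 1)) * effSurplus η v := by
      unfold effSurplus
      rw [mul_rpow hb hv0]; ring
    rw [e] at this
    have e2 : (α - 1) / α * v * Q v = v * Q v - α⁻¹ * (v * Q v) := by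
      field_simp
    simp only [hUdef]
    linarith
  have hWi : Integrable (fun v => α⁻¹ * (v * Q v) - U v) (paretoMeasure α) :=
    (hVi.const_mul _).sub hUi
  rw [integral_add (hS.const_mul _) hWi,
    integral_sub (hVi.const_mul _) hUi, integral_const_mul, integral_const_mul] at hfin
  have : α⁻¹ * ∫ v, v * Q v ∂(paretoMeasure α) ≤ ∫ v, U v ∂(paretoMeasure α) := by
    rw [inv_mul_le_iff₀ hα0]; exact hAB
  linarith

lemma profit_mem (η α : ℝ) (hη : 1 < η) (hα : η / (η - 1) < α) (hα1 : 1 < α) :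
    ((α - 1) / α) ^ (η / (η - 1)) * ∫ v, effSurplus η v ∂(paretoMeasure α)
      ∈ profitSet η (paretoMeasure α) := by
  have hα0 : 0 < α := by linarith
  have hη1 : 0 < η - 1 := by linarith
  have hη0 : 0 < η := by linarith
  set k := η / (η - 1) with hk
  have hk0 : 0 < k := by positivity
  have hk1 : k - 1 = 1 / (η - 1) := by rw [hk]; field_simp; ring
  have hm0 : 0 < k - 1 := by rw [hk1]; positivity
  have hkk : (k - 1) * η = k := by rw [hk1, hk]; field_simp
  set β := (α - 1) / α with hβ
  have hβ0 : 0 < β := div_pos (by linarith) hα0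
  set b := β ^ (k - 1) with hb
  have hb0 : 0 < b := by positivity
  have hbη : b ^ η = β ^ k := by rw [hb, ← rpow_mul hβ0.le, hkk]
  have hbk : β ^ k = b * β := by
    rw [hb, ← rpow_add_one hβ0.ne']; ring_nf
  have vk : ∀ v : ℝ, 1 ≤ v → v * v ^ (k - 1) = v ^ k := by
    intro v hv
    have hv0 : 0 < v := by linarith
    rw [mul_comm, ← rpow_add_one hv0.ne']; ring_nf
  -- tangent inequality for the convex function v ^ k
  have tang : ∀ v w : ℝ, 0 ≤ v → 1 ≤ w → v * w ^ (k - 1) ≤ v ^ k / k + w ^ k * (1 - 1 / k) := by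
    intro v w hv hw
    have hc : k.HolderConjugate η := (Real.HolderConjugate.conjExponent hη).symm
    have hw0 : 0 ≤ w := by linarith
    have := Real.young_inequality_of_nonneg hv (rpow_nonneg hw0 (k - 1)) hc
    rw [← rpow_mul hw0, hkk] at this
    have e : 1 - 1 / k = 1 / η := by rw [hk]; field_simp; ring
    rw [e, mul_one_div]; exact this
  have hI1 := pareto_rpow α k hα0 hα
  have hI0 := pareto_rpow α 0 hα0 hα0
  have hval : ∀ᵐ v ∂(paretoMeasure α), b / (η * α) * v ^ k + b / k * v ^ (0 : ℝ) =
      (if 1 ≤ v then b * (v ^ k - (v ^ k - 1) / k) else 0)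
        - (if 1 ≤ v then b * v ^ (k - 1) else 0) ^ η / η := by
    filter_upwards [pareto_ae α] with v hv
    have hv0 : 0 ≤ v := by linarith
    rw [if_pos hv, if_pos hv, mul_rpow hb0.le (rpow_nonneg hv0 _), ← rpow_mul hv0, hkk, hbη, hbk,
      rpow_zero, hβ, hk]
    field_simp
    ring
  refine ⟨fun v => if 1 ≤ v then b * v ^ (k - 1) else 0,
    fun v => if 1 ≤ v then b * (v ^ k - (v ^ k - 1) / k) else 0, ?_, ?_, ?_, ?_, ?_, ?_, ?_⟩
  · exact Measurable.ite measurableSet_Ici (by fun_prop) (by fun_prop)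
  · exact Measurable.ite measurableSet_Ici (by fun_prop) (by fun_prop)
  · intro v hv
    dsimp only
    split_ifs <;> positivity
  · intro v w hv hw
    dsimp only
    have one_le : ∀ v : ℝ, 1 ≤ v → 0 ≤ b * ((v ^ k - 1) / k) := by
      intro v hv
      have := Real.one_le_rpow hv hk0.le
      have : 0 ≤ v ^ k - 1 := by linarith
      positivity
    by_cases h1 : 1 ≤ v <;> by_cases h2 : 1 ≤ w
    · simp only [if_pos h1, if_pos h2]
      have := mul_le_mul_of_nonneg_left (tang v w hv h2) hb0.le
      have e := vk v h1
      have e2 : v * (b * v ^ (k - 1)) = b * v ^ k := by rw [← e]; ring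
      rw [e2]
      have e3 : b * (v ^ k / k + w ^ k * (1 - 1 / k)) =
        b * (v ^ k / k) + b * w ^ k - b * (w ^ k / k) := by ring
      have e4 : b * ((v ^ k - (v ^ k - 1) / k)) = b * v ^ k - b * (v ^ k / k) + b / k := by ring
      have e5 : b * ((w ^ k - (w ^ k - 1) / k)) = b * w ^ k - b * (w ^ k / k) + b / k := by ring
      rw [e4, e5]
      linarith
    · simp only [if_pos h1, if_neg h2]
      have e := vk v h1
      have := one_le v h1
      have e2 : v * (b * v ^ (k - 1)) = b * v ^ k := by rw [← e]; ring
      rw [e2]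
      linarith
    · simp only [if_neg h1, if_pos h2]
      have t := mul_le_mul_of_nonneg_left (tang 1 w zero_le_one h2) hb0.le
      rw [one_rpow] at t
      have hw1 : 0 ≤ b * w ^ (k - 1) := by positivity
      have h3 : v * (b * w ^ (k - 1)) ≤ 1 * (b * w ^ (k - 1)) :=
        mul_le_mul_of_nonneg_right (by linarith) hw1
      have e5 : b * ((w ^ k - (w ^ k - 1) / k)) = b * (1 / k + w ^ k * (1 - 1 / k)) := by ring
      rw [e5]
      linarith
    · simp only [if_neg h1, if_neg h2]
      exact le_refl _
  · intro v hv
    dsimp only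
    split_ifs with h1
    · have e2 : v * (b * v ^ (k - 1)) = b * v ^ k := by rw [← vk v h1]; ring
      have := Real.one_le_rpow h1 hk0.le
      have h3 : 0 ≤ v ^ k - 1 := by linarith
      have : 0 ≤ b * ((v ^ k - 1) / k) := by positivity
      rw [e2]
      linarith
    · simp
  · exact Integrable.congr ((hI1.1.const_mul _).add (hI0.1.const_mul _)) hval
  · rw [← integral_congr_ae hval, integral_add (hI1.1.const_mul _) (hI0.1.const_mul _),
      integral_const_mul, integral_const_mul, hI1.2, hI0.2]
    unfold effSurplus
    rw [integral_const_mul, ← hk, hI1.2, hbk, hβ]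
    have hak : α - k ≠ 0 := by linarith
    have hηk : η = k / (k - 1) := by rw [eq_div_iff hm0.ne']; linarith
    have hηk' : (η - 1) / η = 1 / k := by rw [hk]; field_simp
    rw [hηk', hηk]
    rw [sub_zero]
    field_simp
    ring

/-- For `η > 1` and `α > η/(η-1)`, the Pareto distribution `P_α` has finite efficient
social surplus `S_{P_α}`, and the Bayes-optimal profit under `P_α` equals
`((α-1)/α) ^ (η/(η-1)) * S_{P_α}`. -/
theorem stmt_5 (η α : ℝ) (hη : 1 < η) (hα : η / (η - 1) < α) :
    Integrable (effSurplus η) (paretoMeasure α) ∧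
    sSup (profitSet η (paretoMeasure α))
      = ((α - 1) / α) ^ (η / (η - 1)) * ∫ v, effSurplus η v ∂(paretoMeasure α) := by
  have hη1 : 0 < η - 1 := by linarith
  have hα1 : 1 < α := by
    refine lt_trans ?_ hα
    rw [lt_div_iff₀ hη1]; linarith
  have hS : Integrable (effSurplus η) (paretoMeasure α) :=
    (pareto_rpow α _ (by linarith) hα).1.const_mul _
  refine ⟨hS, IsGreatest.csSup_eq ⟨profit_mem η α hη hα hα1, ?_⟩⟩
  intro x hx
  exact profit_le η α hη hα hα1 hS x hx
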